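/- Let R be a commutative ring with finite Gorenstein global dimension. The following assertions are equivalent: (1) R is SG-hereditary; (2) for every R-module M there exists a short exact sequence 0 → M → Q → M → 0 with pd_R(Q) ≤ 1; (3) for every R-module M there exists a short exact sequence 0 → M → E → M → 0 with id_R(E) ≤ 1. -/

import Mathlib

noncomputable section

universe u

variable (R : Type u) [CommRing R]

/-- `IsShortExact R f g` says that `0 → A → B → C → 0` is a short exact sequence. -/
def IsShortExact {A B C : Type u} [AddCommGroup A] [Module R A] [AddCommGroup B] [Module R B]
    [AddCommGroup C] [Module R C] (f : A →ₗ[R] B) (g : B →ₗ[R] C) : Prop :=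
  Function.Injective f ∧ Function.Surjective g ∧ LinearMap.range f = LinearMap.ker g

/-- A module `M` is Gorenstein projective if there is a complete projective resolution
`⋯ → P i → P (i+1) → ⋯` (an exact sequence of projective modules which remains exact after
applying `Hom(-, Q)` for every projective module `Q`) with `M ≅ Im (P 0 → P 1)`. -/
def IsGorensteinProjective (M : Type u) [AddCommGroup M] [Module R M] : Prop :=
  ∃ (P : ℤ → Type u) (_ : ∀ i, AddCommGroup (P i)) (_ : ∀ i, Module R (P i))
    (d : ∀ i, P i →ₗ[R] P (i + 1)),
    (∀ i, Module.Projective R (P i)) ∧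
    (∀ i, LinearMap.range (d i) = LinearMap.ker (d (i + 1))) ∧
    Nonempty (M ≃ₗ[R] LinearMap.range (d 0)) ∧
    (∀ (Q : Type u) (_ : AddCommGroup Q) (_ : Module R Q), Module.Projective R Q →
      ∀ (i : ℤ) (g : P (i + 1) →ₗ[R] Q), g.comp (d i) = 0 →
        ∃ h : P (i + 1 + 1) →ₗ[R] Q, h.comp (d (i + 1)) = g)

/-- A module `M` is strongly Gorenstein projective if there is a complete projective
resolution of the form `⋯ → P →f P →f P → ⋯` with `M ≅ Im f`. -/
def IsStronglyGorensteinProjective (M : Type u) [AddCommGroup M] [Module R M] : Prop :=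
  ∃ (P : Type u) (_ : AddCommGroup P) (_ : Module R P) (f : P →ₗ[R] P),
    Module.Projective R P ∧
    LinearMap.range f = LinearMap.ker f ∧
    Nonempty (M ≃ₗ[R] LinearMap.range f) ∧
    (∀ (Q : Type u) (_ : AddCommGroup Q) (_ : Module R Q), Module.Projective R Q →
      ∀ g : P →ₗ[R] Q, g.comp f = 0 → ∃ h : P →ₗ[R] Q, h.comp f = g)

/-- A module `M` is Gorenstein flat if there is an exact sequence of flat modules
`⋯ → F i → F (i+1) → ⋯` which remains exact after applying `- ⊗ I` for every injective
module `I`, with `M ≅ Im (F 0 → F 1)`. -/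
def IsGorensteinFlat (M : Type u) [AddCommGroup M] [Module R M] : Prop :=
  ∃ (F : ℤ → Type u) (_ : ∀ i, AddCommGroup (F i)) (_ : ∀ i, Module R (F i))
    (d : ∀ i, F i →ₗ[R] F (i + 1)),
    (∀ i, Module.Flat R (F i)) ∧
    (∀ i, LinearMap.range (d i) = LinearMap.ker (d (i + 1))) ∧
    Nonempty (M ≃ₗ[R] LinearMap.range (d 0)) ∧
    (∀ (I : Type u) (_ : AddCommGroup I) (_ : Module R I), Module.Injective R I →
      ∀ i : ℤ, LinearMap.range (LinearMap.rTensor I (d i)) =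
        LinearMap.ker (LinearMap.rTensor I (d (i + 1))))

/-- A module `M` is strongly Gorenstein flat if there is an exact sequence of flat modules
of the form `⋯ → F →f F →f F → ⋯` which remains exact after applying `- ⊗ I` for every
injective module `I`, with `M ≅ Im f`. -/
def IsStronglyGorensteinFlat (M : Type u) [AddCommGroup M] [Module R M] : Prop :=
  ∃ (F : Type u) (_ : AddCommGroup F) (_ : Module R F) (f : F →ₗ[R] F),
    Module.Flat R F ∧
    LinearMap.range f = LinearMap.ker f ∧
    Nonempty (M ≃ₗ[R] LinearMap.range f) ∧
    (∀ (I : Type u) (_ : AddCommGroup I) (_ : Module R I), Module.Injective R I →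
      LinearMap.range (LinearMap.rTensor I f) = LinearMap.ker (LinearMap.rTensor I f))

/-- `ProjDimLE R M n` : the projective dimension of `M` is at most `n`, i.e. there is an exact
sequence `0 → P n → ⋯ → P 0 → M → 0` with each `P i` projective. -/
def ProjDimLE (M : Type u) [AddCommGroup M] [Module R M] (n : ℕ) : Prop :=
  ∃ (P : ℕ → Type u) (_ : ∀ i, AddCommGroup (P i)) (_ : ∀ i, Module R (P i))
    (d : ∀ i, P (i + 1) →ₗ[R] P i) (ε : P 0 →ₗ[R] M),
    (∀ i, Module.Projective R (P i)) ∧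
    (∀ i, n < i → Subsingleton (P i)) ∧
    Function.Surjective ε ∧
    LinearMap.ker ε = LinearMap.range (d 0) ∧
    (∀ i, LinearMap.ker (d i) = LinearMap.range (d (i + 1)))

/-- `InjDimLE R M n` : the injective dimension of `M` is at most `n`, i.e. there is an exact
sequence `0 → M → E 0 → ⋯ → E n → 0` with each `E i` injective. -/
def InjDimLE (M : Type u) [AddCommGroup M] [Module R M] (n : ℕ) : Prop :=
  ∃ (E : ℕ → Type u) (_ : ∀ i, AddCommGroup (E i)) (_ : ∀ i, Module R (E i))
    (d : ∀ i, E i →ₗ[R] E (i + 1)) (η : M →ₗ[R] E 0),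
    (∀ i, Module.Injective R (E i)) ∧
    (∀ i, n < i → Subsingleton (E i)) ∧
    Function.Injective η ∧
    LinearMap.range η = LinearMap.ker (d 0) ∧
    (∀ i, LinearMap.range (d i) = LinearMap.ker (d (i + 1)))

/-- `FlatDimLE R M n` : the flat dimension of `M` is at most `n`. -/
def FlatDimLE (M : Type u) [AddCommGroup M] [Module R M] (n : ℕ) : Prop :=
  ∃ (F : ℕ → Type u) (_ : ∀ i, AddCommGroup (F i)) (_ : ∀ i, Module R (F i))
    (d : ∀ i, F (i + 1) →ₗ[R] F i) (ε : F 0 →ₗ[R] M),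
    (∀ i, Module.Flat R (F i)) ∧
    (∀ i, n < i → Subsingleton (F i)) ∧
    Function.Surjective ε ∧
    LinearMap.ker ε = LinearMap.range (d 0) ∧
    (∀ i, LinearMap.ker (d i) = LinearMap.range (d (i + 1)))

/-- `GProjDimLE R M n` : the Gorenstein projective dimension of `M` is at most `n`, i.e.
there is an exact sequence `0 → G n → ⋯ → G 0 → M → 0` with each `G i` Gorenstein
projective. -/
def GProjDimLE (M : Type u) [AddCommGroup M] [Module R M] (n : ℕ) : Prop :=
  ∃ (G : ℕ → Type u) (_ : ∀ i, AddCommGroup (G i)) (_ : ∀ i, Module R (G i))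
    (d : ∀ i, G (i + 1) →ₗ[R] G i) (ε : G 0 →ₗ[R] M),
    (∀ i, IsGorensteinProjective R (G i)) ∧
    (∀ i, n < i → Subsingleton (G i)) ∧
    Function.Surjective ε ∧
    LinearMap.ker ε = LinearMap.range (d 0) ∧
    (∀ i, LinearMap.ker (d i) = LinearMap.range (d (i + 1)))

/-- `GFlatDimLE R M n` : the Gorenstein flat dimension of `M` is at most `n`. -/
def GFlatDimLE (M : Type u) [AddCommGroup M] [Module R M] (n : ℕ) : Prop :=
  ∃ (G : ℕ → Type u) (_ : ∀ i, AddCommGroup (G i)) (_ : ∀ i, Module R (G i))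
    (d : ∀ i, G (i + 1) →ₗ[R] G i) (ε : G 0 →ₗ[R] M),
    (∀ i, IsGorensteinFlat R (G i)) ∧
    (∀ i, n < i → Subsingleton (G i)) ∧
    Function.Surjective ε ∧
    LinearMap.ker ε = LinearMap.range (d 0) ∧
    (∀ i, LinearMap.ker (d i) = LinearMap.range (d (i + 1)))

/-- A module is finitely presented if it is the quotient of a finite free module by a
finitely generated submodule of relations. -/
def IsFinitelyPresented (M : Type u) [AddCommGroup M] [Module R M] : Prop :=
  ∃ (n : ℕ) (f : (Fin n → R) →ₗ[R] M), Function.Surjective f ∧ (LinearMap.ker f).FG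

/-- A ring is coherent if every finitely generated ideal is finitely presented. -/
def IsCoherentRing : Prop :=
  ∀ I : Ideal R, I.FG → IsFinitelyPresented R I

/-- `ExtVanishes R M N i` : `Ext_R^i(M, N) = 0`. -/
def ExtVanishes (M N : Type u) [AddCommGroup M] [Module R M] [AddCommGroup N] [Module R N]
    (i : ℕ) : Prop :=
  Subsingleton (((Ext R (ModuleCat.{u} R) i).obj
    (Opposite.op (ModuleCat.of R M))).obj (ModuleCat.of R N))

/-- A ring is hereditary if every submodule of a projective module is projective. -/
def IsHereditaryRing : Prop :=
  ∀ (P : Type u) (_ : AddCommGroup P) (_ : Module R P), Module.Projective R P →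
    ∀ N : Submodule R P, Module.Projective R N

/-- A ring is semihereditary if every finitely generated ideal is projective. -/
def IsSemihereditaryRing : Prop :=
  ∀ I : Ideal R, I.FG → Module.Projective R I

/-- A ring is Gorenstein hereditary if every submodule of a projective module is
Gorenstein projective. -/
def IsGHereditaryRing : Prop :=
  ∀ (P : Type u) (_ : AddCommGroup P) (_ : Module R P), Module.Projective R P →
    ∀ N : Submodule R P, IsGorensteinProjective R N

/-- A ring is strongly Gorenstein hereditary if every submodule of a projective module is
strongly Gorenstein projective. -/
def IsSGHereditaryRing : Prop :=
  ∀ (P : Type u) (_ : AddCommGroup P) (_ : Module R P), Module.Projective R P →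
    ∀ N : Submodule R P, IsStronglyGorensteinProjective R N

/-- A ring is Gorenstein semihereditary if it is coherent and every submodule of a flat
module is Gorenstein flat. -/
def IsGSemihereditaryRing : Prop :=
  IsCoherentRing R ∧
    ∀ (F : Type u) (_ : AddCommGroup F) (_ : Module R F), Module.Flat R F →
      ∀ N : Submodule R F, IsGorensteinFlat R N

/-- A ring is strongly Gorenstein semihereditary if it is coherent and every submodule of a
flat module is strongly Gorenstein flat. -/
def IsSGSemihereditaryRing : Prop :=
  IsCoherentRing R ∧
    ∀ (F : Type u) (_ : AddCommGroup F) (_ : Module R F), Module.Flat R F →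
      ∀ N : Submodule R F, IsStronglyGorensteinFlat R N

section HomologicalLemmas

open CategoryTheory Abelian

variable {R}
variable {A B C A' B' L M N P Q X Y : Type u}
  [AddCommGroup A] [Module R A] [AddCommGroup B] [Module R B] [AddCommGroup C] [Module R C]
  [AddCommGroup A'] [Module R A'] [AddCommGroup B'] [Module R B']
  [AddCommGroup L] [Module R L] [AddCommGroup M] [Module R M] [AddCommGroup N] [Module R N]
  [AddCommGroup P] [Module R P] [AddCommGroup Q] [Module R Q] [AddCommGroup X] [Module R X]
  [AddCommGroup Y] [Module R Y]

namespace IsShortExact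

variable {f : A →ₗ[R] B} {g : B →ₗ[R] C}

theorem comp_eq_zero (h : IsShortExact R f g) : g.comp f = 0 :=
  LinearMap.range_le_ker_iff.1 h.2.2.le

theorem apply_apply_eq_zero (h : IsShortExact R f g) (a : A) : g (f a) = 0 :=
  LinearMap.congr_fun h.comp_eq_zero a

theorem exists_of_apply_eq_zero (h : IsShortExact R f g) {b : B} (hb : g b = 0) :
    ∃ a, f a = b :=
  h.2.2.ge hb

theorem mkQ_range (hf : Function.Injective f) : IsShortExact R f (LinearMap.range f).mkQ :=
  ⟨hf, Submodule.mkQ_surjective _, (Submodule.ker_mkQ _).symm⟩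

theorem subtype_ker (hg : Function.Surjective g) : IsShortExact R (LinearMap.ker g).subtype g :=
  ⟨Subtype.val_injective, hg, Submodule.range_subtype _⟩

/-- A linear map vanishing on the kernel of a short exact sequence factors through the cokernel. -/
theorem exists_factor (h : IsShortExact R f g) (φ : B →ₗ[R] X) (hφ : φ.comp f = 0) :
    ∃ ψ : C →ₗ[R] X, ψ.comp g = φ := by
  have hle : LinearMap.ker g ≤ LinearMap.ker φ := h.2.2 ▸ LinearMap.range_le_ker_iff.2 hφ
  refine ⟨(LinearMap.ker g).liftQ φ hle ∘ₗ (g.quotKerEquivOfSurjective h.2.1).symm, ?_⟩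
  ext b
  have : (g.quotKerEquivOfSurjective h.2.1).symm (g b) = (LinearMap.ker g).mkQ b := by
    rw [LinearEquiv.symm_apply_eq]; rfl
  simp [this]

end IsShortExact

/-- The short exact sequence in `ModuleCat R` given by linear maps. -/
theorem IsShortExact.exists_shortExact {f : A →ₗ[R] B} {g : B →ₗ[R] C}
    (h : IsShortExact R f g) :
    ∃ w, (ShortComplex.mk (ModuleCat.ofHom f) (ModuleCat.ofHom g) w).ShortExact := by
  have w : ModuleCat.ofHom f ≫ ModuleCat.ofHom g = 0 := by
    rw [← ModuleCat.ofHom_comp, h.comp_eq_zero]; rfl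
  refine ⟨w, ModuleCat.shortComplex_shortExact _ ?_ h.1 h.2.1⟩
  exact LinearMap.exact_iff.2 h.2.2.symm

variable (R M N) in
/-- The vanishing of the `i`-th extension group from `M` to `N`. -/
def ExtZero (i : ℕ) : Prop :=
  Subsingleton (Abelian.Ext (ModuleCat.of R M) (ModuleCat.of R N) i)

theorem ExtZero.mk {i : ℕ}
    (h : ∀ x : Abelian.Ext (ModuleCat.of R M) (ModuleCat.of R N) i, x = 0) : ExtZero R M N i :=
  subsingleton_of_forall_eq 0 h

theorem ExtZero.eq_zero {i : ℕ} (h : ExtZero R M N i)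
    (x : Abelian.Ext (ModuleCat.of R M) (ModuleCat.of R N) i) : x = 0 :=
  have : Subsingleton _ := h
  Subsingleton.elim _ _

theorem ExtZero.of_projective [Module.Projective R M] (i : ℕ) : ExtZero R M N (i + 1) :=
  have : Projective (ModuleCat.of R M) := (IsProjective.iff_projective M).1 inferInstance
  .mk Ext.eq_zero_of_projective

theorem ExtZero.of_injective [Module.Injective R N] (i : ℕ) : ExtZero R M N (i + 1) :=
  have : Injective (ModuleCat.of R N) := Module.injective_object_of_injective_module R N
  .mk Ext.eq_zero_of_injective

theorem projective_of_extZero (h : ∀ (Y : Type u) [AddCommGroup Y] [Module R Y],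
    ExtZero R M Y 1) : Module.Projective R M := by
  rw [IsProjective.iff_projective, projective_iff_subsingleton_ext_one]
  exact fun {Y} => h Y

theorem injective_of_extZero (h : ∀ (X : Type u) [AddCommGroup X] [Module R X],
    ExtZero R X M 1) : Module.Injective R M := by
  rw [Module.injective_iff_injective_object, injective_iff_subsingleton_ext_one]
  exact fun {X} => h X

theorem ExtZero.of_retract {i : ℕ} {s : M →ₗ[R] N} {r : N →ₗ[R] M} (hrs : r.comp s = .id)
    (h : ExtZero R N Y i) : ExtZero R M Y i := by
  refine .mk fun x => ?_
  have hid : ModuleCat.ofHom s ≫ ModuleCat.ofHom r = 𝟙 (ModuleCat.of R M) := by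
    rw [← ModuleCat.ofHom_comp, hrs]; rfl
  rw [← Ext.mk₀_id_comp x, ← hid, ← Ext.mk₀_comp_mk₀_assoc, h.eq_zero ((Ext.mk₀ _).comp x _),
    Ext.comp_zero]

namespace IsShortExact

variable {f : A →ₗ[R] B} {g : B →ₗ[R] C} {i : ℕ}

theorem extZero_right (h : IsShortExact R f g) (hA : ExtZero R A Y i)
    (hB : ExtZero R B Y (i + 1)) : ExtZero R C Y (i + 1) := by
  obtain ⟨w, hS⟩ := h.exists_shortExact
  refine .mk fun x => ?_
  obtain ⟨y, rfl⟩ := Ext.contravariant_sequence_exact₃ hS _ x (hB.eq_zero _) (add_comm 1 i)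
  rw [hA.eq_zero y, Ext.comp_zero]

theorem extZero_left (h : IsShortExact R f g) (hB : ExtZero R B Y i)
    (hC : ExtZero R C Y (i + 1)) : ExtZero R A Y i := by
  obtain ⟨w, hS⟩ := h.exists_shortExact
  refine .mk fun x => ?_
  obtain ⟨y, rfl⟩ := Ext.contravariant_sequence_exact₁ hS _ x (add_comm 1 i) (hC.eq_zero _)
  rw [hB.eq_zero y, Ext.comp_zero]

theorem extZero_middle (h : IsShortExact R f g) (hA : ExtZero R A Y i)
    (hC : ExtZero R C Y i) : ExtZero R B Y i := by
  obtain ⟨w, hS⟩ := h.exists_shortExact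
  refine .mk fun x => ?_
  obtain ⟨y, rfl⟩ := Ext.contravariant_sequence_exact₂ hS _ x (hA.eq_zero _)
  rw [hC.eq_zero y, Ext.comp_zero]

theorem extZero_of_left (h : IsShortExact R f g) (hC : ExtZero R X C i)
    (hB : ExtZero R X B (i + 1)) : ExtZero R X A (i + 1) := by
  obtain ⟨w, hS⟩ := h.exists_shortExact
  refine .mk fun x => ?_
  obtain ⟨y, rfl⟩ := Ext.covariant_sequence_exact₁ _ hS x (hB.eq_zero _) rfl
  rw [hC.eq_zero y, Ext.zero_comp]

theorem extZero_of_right (h : IsShortExact R f g) (hB : ExtZero R X B i)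
    (hA : ExtZero R X A (i + 1)) : ExtZero R X C i := by
  obtain ⟨w, hS⟩ := h.exists_shortExact
  refine .mk fun x => ?_
  obtain ⟨y, rfl⟩ := Ext.covariant_sequence_exact₃ _ hS x rfl (hA.eq_zero _)
  rw [hB.eq_zero y, Ext.zero_comp]

/-- Linear maps extend along `f` when the first extension group from the cokernel vanishes. -/
theorem exists_extension (h : IsShortExact R f g) (hC : ExtZero R C Y 1) (φ : A →ₗ[R] Y) :
    ∃ ψ : B →ₗ[R] Y, ψ.comp f = φ := by
  obtain ⟨w, hS⟩ := h.exists_shortExact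
  obtain ⟨y, hy⟩ := Ext.contravariant_sequence_exact₁ hS _ (Ext.mk₀ (ModuleCat.ofHom φ))
    (add_zero 1) (hC.eq_zero _)
  obtain ⟨ψ, rfl⟩ := (Ext.mk₀_bijective _ _).2 y
  rw [Ext.mk₀_comp_mk₀] at hy
  exact ⟨ψ.hom, congrArg ModuleCat.Hom.hom ((Ext.mk₀_bijective _ _).1 hy)⟩

theorem extZero_one_of_extension [Module.Projective R B] (h : IsShortExact R f g)
    (hext : ∀ φ : A →ₗ[R] Y, ∃ ψ : B →ₗ[R] Y, ψ.comp f = φ) : ExtZero R C Y 1 := by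
  obtain ⟨w, hS⟩ := h.exists_shortExact
  refine .mk fun x => ?_
  obtain ⟨y, rfl⟩ := Ext.contravariant_sequence_exact₃ hS _ x
    ((ExtZero.of_projective (R := R) (M := B) (N := Y) 0).eq_zero _) (add_zero 1)
  obtain ⟨φ, rfl⟩ := (Ext.mk₀_bijective _ _).2 y
  obtain ⟨ψ, hψ⟩ := hext φ.hom
  have : φ = ModuleCat.ofHom f ≫ ModuleCat.ofHom ψ := by
    rw [← ModuleCat.ofHom_comp, hψ]; rfl
  rw [this, ← Ext.mk₀_comp_mk₀]
  exact hS.extClass_comp_assoc _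

end IsShortExact

theorem IsShortExact.of_forall {f : A →ₗ[R] B} {g : B →ₗ[R] C} (hf : Function.Injective f)
    (hg : Function.Surjective g) (hfg : ∀ a, g (f a) = 0) (h : ∀ b, g b = 0 → ∃ a, f a = b) :
    IsShortExact R f g :=
  ⟨hf, hg, le_antisymm (by rintro _ ⟨a, rfl⟩; exact hfg a) fun b hb => h b hb⟩

theorem IsShortExact.comp_equiv {f : A →ₗ[R] B} {g : B →ₗ[R] C} (h : IsShortExact R f g)
    (e : X ≃ₗ[R] A) : IsShortExact R (f.comp e.toLinearMap) g := by
  refine .of_forall (h.1.comp e.injective) h.2.1 (fun x => h.apply_apply_eq_zero _) fun b hb => ?_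
  obtain ⟨a, rfl⟩ := h.exists_of_apply_eq_zero hb
  exact ⟨e.symm a, by simp⟩

/-- The third isomorphism theorem for a composite of two injections with given cokernels. -/
theorem IsShortExact.exists_comp {f : A →ₗ[R] B} {g : B →ₗ[R] A'} (h : IsShortExact R f g)
    {i : B →ₗ[R] P} {p : P →ₗ[R] B'} (hP : IsShortExact R i p) :
    ∃ (C : Type u) (_ : AddCommGroup C) (_ : Module R C) (q : P →ₗ[R] C) (u : A' →ₗ[R] C)
      (v : C →ₗ[R] B'), IsShortExact R (i.comp f) q ∧ IsShortExact R u v := by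
  have hq : IsShortExact R (i.comp f) (LinearMap.range (i.comp f)).mkQ := .mkQ_range (hP.1.comp h.1)
  generalize (LinearMap.range (i.comp f)).mkQ = q at hq
  obtain ⟨u, hu⟩ := h.exists_factor (q.comp i) hq.comp_eq_zero
  obtain ⟨v, hv⟩ := hq.exists_factor p (by rw [← LinearMap.comp_assoc, hP.comp_eq_zero]; simp)
  replace hu : ∀ b, u (g b) = q (i b) := LinearMap.congr_fun hu
  replace hv : ∀ x, v (q x) = p x := LinearMap.congr_fun hv
  refine ⟨_, _, _, q, u, v, hq, .of_forall ?_ ?_ ?_ ?_⟩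
  · rw [injective_iff_map_eq_zero]
    intro a' ha'
    obtain ⟨b, rfl⟩ := h.2.1 a'
    obtain ⟨a, ha⟩ := hq.exists_of_apply_eq_zero ((hu b).symm.trans ha')
    rw [← hP.1 ha]
    exact h.apply_apply_eq_zero a
  · intro b'
    obtain ⟨x, rfl⟩ := hP.2.1 b'
    exact ⟨q x, hv x⟩
  · intro a'
    obtain ⟨b, rfl⟩ := h.2.1 a'
    rw [hu, hv, hP.apply_apply_eq_zero]
  · intro c hc
    obtain ⟨x, rfl⟩ := hq.2.1 c
    obtain ⟨b, rfl⟩ := hP.exists_of_apply_eq_zero ((hv x).symm.trans hc)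
    exact ⟨g b, hu b⟩

/-- The horseshoe lemma for embeddings of the two ends of a short exact sequence, the first of
which extends to the middle term. -/
theorem IsShortExact.exists_horseshoe {f : A →ₗ[R] N} {g : N →ₗ[R] B} (h : IsShortExact R f g)
    {i : A →ₗ[R] P} {p : P →ₗ[R] A'} (hA : IsShortExact R i p)
    {j : B →ₗ[R] Q} {r : Q →ₗ[R] B'} (hB : IsShortExact R j r)
    {a : N →ₗ[R] P} (ha : a.comp f = i) :
    ∃ (C : Type u) (_ : AddCommGroup C) (_ : Module R C) (q : P × Q →ₗ[R] C) (u : A' →ₗ[R] C)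
      (v : C →ₗ[R] B'), IsShortExact R (a.prod (j.comp g)) q ∧ IsShortExact R u v := by
  replace ha : ∀ x, a (f x) = i x := LinearMap.congr_fun ha
  have hinj : Function.Injective (a.prod (j.comp g)) := by
    rw [injective_iff_map_eq_zero]
    intro n hn
    obtain ⟨x, rfl⟩ := h.exists_of_apply_eq_zero
      ((map_eq_zero_iff j hB.1).1 (congrArg Prod.snd hn))
    have : i x = 0 := (ha x).symm.trans (congrArg Prod.fst hn)
    rw [(map_eq_zero_iff i hA.1).1 this, map_zero]
  have hq := IsShortExact.mkQ_range hinj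
  generalize (LinearMap.range (a.prod (j.comp g))).mkQ = q at hq
  have hq0 : ∀ n, q (a n, j (g n)) = 0 := hq.apply_apply_eq_zero
  obtain ⟨u, hu⟩ := hA.exists_factor (q.comp (.inl R P Q)) (by
    ext x
    simpa [ha, h.apply_apply_eq_zero] using hq0 (f x))
  obtain ⟨v, hv⟩ := hq.exists_factor (r.comp (.snd R P Q)) (by
    ext n
    simp [hB.apply_apply_eq_zero])
  replace hu : ∀ x, u (p x) = q (x, 0) := LinearMap.congr_fun hu
  replace hv : ∀ x y, v (q (x, y)) = r y := fun x y => LinearMap.congr_fun hv (x, y)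
  refine ⟨_, _, _, q, u, v, hq, .of_forall ?_ ?_ ?_ ?_⟩
  · rw [injective_iff_map_eq_zero]
    intro a' ha'
    obtain ⟨x, rfl⟩ := hA.2.1 a'
    obtain ⟨n, hn⟩ := hq.exists_of_apply_eq_zero ((hu x).symm.trans ha')
    obtain ⟨y, rfl⟩ := h.exists_of_apply_eq_zero
      ((map_eq_zero_iff j hB.1).1 (congrArg Prod.snd hn))
    have : i y = x := (ha y).symm.trans (congrArg Prod.fst hn)
    rw [← this, hA.apply_apply_eq_zero]
  · intro b'
    obtain ⟨y, rfl⟩ := hB.2.1 b'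
    exact ⟨q (0, y), hv 0 y⟩
  · intro a'
    obtain ⟨x, rfl⟩ := hA.2.1 a'
    rw [hu, hv, map_zero]
  · intro c hc
    obtain ⟨⟨x, y⟩, rfl⟩ := hq.2.1 c
    obtain ⟨b, rfl⟩ := hB.exists_of_apply_eq_zero ((hv x y).symm.trans hc)
    obtain ⟨n, rfl⟩ := h.2.1 b
    refine ⟨p (x - a n), ?_⟩
    have : ((x - a n, 0) : P × Q) = (x, j (g n)) - (a n, j (g n)) := by simp
    rw [hu, this, map_sub, hq0, sub_zero]

/-- The horseshoe lemma for a projective cover of both ends of a self-extension. -/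
theorem IsShortExact.exists_projective_horseshoe {ι : M →ₗ[R] Q} {π : Q →ₗ[R] M}
    (h : IsShortExact R ι π) {i : N →ₗ[R] P} {p : P →ₗ[R] M} (hP : IsShortExact R i p)
    [Module.Projective R P] :
    ∃ (K : Type u) (_ : AddCommGroup K) (_ : Module R K) (k : K →ₗ[R] P × P) (q : P × P →ₗ[R] Q)
      (α : N →ₗ[R] K) (β : K →ₗ[R] N), IsShortExact R k q ∧ IsShortExact R α β := by
  obtain ⟨s, hs⟩ := Module.projective_lifting_property π p h.2.1
  replace hs : ∀ x, π (s x) = p x := LinearMap.congr_fun hs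
  let q : P × P →ₗ[R] Q := (ι.comp p).coprod s
  have hqdef : ∀ x y, q (x, y) = ι (p x) + s y := fun x y => LinearMap.coprod_apply _ _ _
  have hπq : ∀ x y, π (q (x, y)) = p y := fun x y => by
    rw [hqdef, map_add, h.apply_apply_eq_zero, hs, zero_add]
  have hq : Function.Surjective q := by
    intro z
    obtain ⟨y, hy⟩ := hP.2.1 (π z)
    obtain ⟨m, hm⟩ := h.exists_of_apply_eq_zero (b := z - s y) (by rw [map_sub, hs, hy, sub_self])
    obtain ⟨x, rfl⟩ := hP.2.1 m
    exact ⟨(x, y), by rw [hqdef, hm, sub_add_cancel]⟩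
  let α : N →ₗ[R] LinearMap.ker q := LinearMap.codRestrict _ ((LinearMap.inl R P P).comp i)
    fun n => by simp [hqdef, hP.apply_apply_eq_zero]
  let e := LinearEquiv.ofInjective i hP.1
  let β : LinearMap.ker q →ₗ[R] N := e.symm.toLinearMap.comp
    (LinearMap.codRestrict (LinearMap.range i) ((LinearMap.snd R P P).comp (Submodule.subtype _))
      fun x => by
        obtain ⟨⟨x, y⟩, hxy⟩ := x
        rw [hP.2.2]
        exact (hπq x y).symm.trans (by rw [LinearMap.mem_ker.1 hxy, map_zero]))
  have hβ : ∀ x, i (β x) = x.1.2 := fun x =>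
    congrArg Subtype.val (e.apply_symm_apply _)
  refine ⟨_, _, _, _, q, α, β, .subtype_ker hq, .of_forall ?_ ?_ ?_ ?_⟩
  · intro n n' hn
    exact hP.1 (congrArg (fun z => z.1.1) hn)
  · intro n
    obtain ⟨m, hm⟩ := h.exists_of_apply_eq_zero (b := s (i n))
      (by rw [hs, hP.apply_apply_eq_zero])
    obtain ⟨x, rfl⟩ := hP.2.1 m
    exact ⟨⟨(-x, i n), by simp [hqdef, hm]⟩, hP.1 (hβ _)⟩
  · intro n
    exact hP.1 (by rw [hβ, map_zero]; rfl)
  · intro x hx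
    obtain ⟨⟨x, y⟩, hxy⟩ := x
    have hy : y = 0 := by simpa [hx] using (hβ ⟨(x, y), hxy⟩).symm
    subst hy
    obtain ⟨n, rfl⟩ := hP.exists_of_apply_eq_zero (b := x)
      (h.1 (by simpa [hqdef] using hxy))
    exact ⟨n, rfl⟩

theorem projDimLE_one_iff : ProjDimLE R Q 1 ↔
    ∃ (P₁ P₀ : Type u) (_ : AddCommGroup P₁) (_ : Module R P₁) (_ : AddCommGroup P₀)
      (_ : Module R P₀) (f : P₁ →ₗ[R] P₀) (g : P₀ →ₗ[R] Q),
      Module.Projective R P₁ ∧ Module.Projective R P₀ ∧ IsShortExact R f g := by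
  constructor
  · rintro ⟨P, _, _, d, ε, hP, hsub, hε, h0, hd⟩
    refine ⟨P 1, P 0, _, _, _, _, d 0, ε, hP 1, hP 0, ?_, hε, h0.symm⟩
    have := hsub 2 (by norm_num)
    rw [← LinearMap.ker_eq_bot, hd 0, LinearMap.range_eq_bot]
    exact Subsingleton.elim _ _
  · rintro ⟨P₁, P₀, _, _, _, _, f, g, h₁, h₀, h⟩
    let S : ℕ → ModuleCat.{u} R := fun
      | 0 => .of R P₀
      | 1 => .of R P₁
      | _ + 2 => .of R PUnit.{u + 1}
    let d : ∀ i, S (i + 1) →ₗ[R] S i := fun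
      | 0 => f
      | _ + 1 => 0
    refine ⟨fun i => S i, fun i => inferInstance, fun i => inferInstance, d, g, ?_, ?_, h.2.1,
      h.2.2.symm, ?_⟩
    · rintro (_ | _ | i)
      · exact h₀
      · exact h₁
      · exact inferInstanceAs (Module.Projective R PUnit.{u + 1})
    · rintro (_ | _ | i) hi
      · omega
      · omega
      · exact inferInstanceAs (Subsingleton PUnit.{u + 1})
    · rintro (_ | i)
      · exact (LinearMap.ker_eq_bot.2 h.1).trans LinearMap.range_zero.symm
      · have : Subsingleton (S (i + 1 + 1)) := inferInstanceAs (Subsingleton PUnit.{u + 1})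
        exact Subsingleton.elim _ _

theorem injDimLE_one_iff : InjDimLE R Q 1 ↔
    ∃ (I₀ I₁ : Type u) (_ : AddCommGroup I₀) (_ : Module R I₀) (_ : AddCommGroup I₁)
      (_ : Module R I₁) (f : Q →ₗ[R] I₀) (g : I₀ →ₗ[R] I₁),
      Module.Injective R I₀ ∧ Module.Injective R I₁ ∧ IsShortExact R f g := by
  constructor
  · rintro ⟨E, _, _, d, η, hE, hsub, hη, h0, hd⟩
    refine ⟨E 0, E 1, _, _, _, _, η, d 0, hE 0, hE 1, hη, ?_, h0⟩
    have := hsub 2 (by norm_num)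
    rw [← LinearMap.range_eq_top, hd 0, LinearMap.ker_eq_top]
    exact Subsingleton.elim _ _
  · rintro ⟨I₀, I₁, _, _, _, _, f, g, h₀, h₁, h⟩
    let S : ℕ → ModuleCat.{u} R := fun
      | 0 => .of R I₀
      | 1 => .of R I₁
      | _ + 2 => .of R PUnit.{u + 1}
    let d : ∀ i, S i →ₗ[R] S (i + 1) := fun
      | 0 => g
      | _ + 1 => 0
    refine ⟨fun i => S i, fun i => inferInstance, fun i => inferInstance, d, f, ?_, ?_, h.1,
      h.2.2, ?_⟩
    · rintro (_ | _ | i)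
      · exact h₀
      · exact h₁
      · exact ⟨fun _ _ _ _ _ _ _ _ _ => ⟨0, fun _ => rfl⟩⟩
    · rintro (_ | _ | i) hi
      · omega
      · omega
      · exact inferInstanceAs (Subsingleton PUnit.{u + 1})
    · rintro (_ | i)
      · exact (LinearMap.range_eq_top.2 h.2.1).trans LinearMap.ker_zero.symm
      · have : Subsingleton (S (i + 1 + 1)) := inferInstanceAs (Subsingleton PUnit.{u + 1})
        exact Subsingleton.elim _ _

theorem ProjDimLE.extZero (h : ProjDimLE R Q 1) (i : ℕ) : ExtZero R Q Y (i + 2) := by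
  obtain ⟨P₁, P₀, _, _, _, _, f, g, _, _, h⟩ := projDimLE_one_iff.1 h
  exact h.extZero_right (.of_projective i) (.of_projective (i + 1))

theorem InjDimLE.extZero (h : InjDimLE R Q 1) (i : ℕ) : ExtZero R X Q (i + 2) := by
  obtain ⟨I₀, I₁, _, _, _, _, f, g, _, _, h⟩ := injDimLE_one_iff.1 h
  exact h.extZero_of_left (.of_injective i) (.of_injective (i + 1))

theorem projDimLE_one_of_extZero (h : ∀ (Y : Type u) [AddCommGroup Y] [Module R Y],
    ExtZero R Q Y 2) : ProjDimLE R Q 1 := by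
  have hs := IsShortExact.subtype_ker (Finsupp.linearCombination_surjective R
    (v := (id : Q → Q)) Function.surjective_id)
  refine projDimLE_one_iff.2 ⟨_, _, _, _, _, _, _, _, ?_, inferInstance, hs⟩
  exact projective_of_extZero fun Y => hs.extZero_left (.of_projective 0) (h Y)

theorem injDimLE_one_of_extZero (h : ∀ (X : Type u) [AddCommGroup X] [Module R X],
    ExtZero R X Q 2) : InjDimLE R Q 1 := by
  let I := Injective.under (ModuleCat.of R Q)
  have : Injective (ModuleCat.of R I) := Injective.injective_under (ModuleCat.of R Q)
  have hI : Module.Injective R I := Module.injective_module_of_injective_object R I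
  have hs := IsShortExact.mkQ_range (f := (Injective.ι (ModuleCat.of R Q)).hom)
    ((ModuleCat.mono_iff_injective _).1 inferInstance)
  refine injDimLE_one_iff.2 ⟨_, _, _, _, _, _, _, _, hI, ?_, hs⟩
  exact injective_of_extZero fun X => hs.extZero_of_right (.of_injective 0) (h X)

theorem GProjDimLE.exists_of_zero (h : GProjDimLE R M 0) :
    ∃ (G : Type u) (_ : AddCommGroup G) (_ : Module R G),
      IsGorensteinProjective R G ∧ Nonempty (M ≃ₗ[R] G) := by
  obtain ⟨G, _, _, d, ε, hG, hsub, hε, h0, hd⟩ := h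
  have := hsub 1 (by norm_num)
  have hinj : Function.Injective ε := by
    rw [← LinearMap.ker_eq_bot, h0, LinearMap.range_eq_bot]
    exact Subsingleton.elim _ _
  exact ⟨G 0, _, _, hG 0, ⟨(LinearEquiv.ofBijective ε ⟨hinj, hε⟩).symm⟩⟩

theorem GProjDimLE.exists_of_succ {n : ℕ} (h : GProjDimLE R M (n + 1)) :
    ∃ (K G : Type u) (_ : AddCommGroup K) (_ : Module R K) (_ : AddCommGroup G) (_ : Module R G)
      (f : K →ₗ[R] G) (g : G →ₗ[R] M),
      GProjDimLE R K n ∧ IsGorensteinProjective R G ∧ IsShortExact R f g := by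
  obtain ⟨G, _, _, d, ε, hG, hsub, hε, h0, hd⟩ := h
  refine ⟨LinearMap.ker ε, G 0, _, _, _, _, _, ε, ?_, hG 0, .subtype_ker hε⟩
  let δ : G 1 →ₗ[R] LinearMap.ker ε :=
    LinearMap.codRestrict _ (d 0) fun x => h0.ge (LinearMap.mem_range_self _ x)
  refine ⟨fun i => G (i + 1), _, _, fun i => d (i + 1), δ, fun i => hG _,
    fun i hi => hsub _ (by omega), ?_, ?_, fun i => hd _⟩
  · rintro ⟨x, hx⟩
    obtain ⟨y, hy⟩ := h0.le hx
    exact ⟨y, Subtype.ext hy⟩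
  · rw [LinearMap.ker_codRestrict, hd 0]

variable (R) in
/-- `M` is the start of an exact sequence `0 → M → P₁ → ⋯ → Pₖ` with each `Pᵢ` projective, which
stays exact under `Hom(-, L)` for every projective module `L`. -/
def HasTotalCoresolution : ℕ → ∀ (M : Type u) [AddCommGroup M] [Module R M], Prop
  | 0, _, _, _ => True
  | k + 1, M, _, _ =>
    (∀ (L : Type u) [AddCommGroup L] [Module R L], Module.Projective R L → ExtZero R M L 1) ∧
    ∃ (P N : Type u) (_ : AddCommGroup P) (_ : Module R P) (_ : AddCommGroup N) (_ : Module R N)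
      (f : M →ₗ[R] P) (g : P →ₗ[R] N),
      Module.Projective R P ∧ IsShortExact R f g ∧ HasTotalCoresolution k N

theorem HasTotalCoresolution.of_equiv {k : ℕ} (h : HasTotalCoresolution R k M) (e : N ≃ₗ[R] M) :
    HasTotalCoresolution R k N := by
  cases k with
  | zero => trivial
  | succ k =>
    obtain ⟨hL, P, N, _, _, _, _, f, g, hP, hs, hN⟩ := h
    exact ⟨fun L _ _ hL' => (hL L hL').of_retract (s := e.toLinearMap) (r := e.symm.toLinearMap)
      (by ext; simp), P, N, _, _, _, _, _, g, hP, hs.comp_equiv e, hN⟩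

theorem HasTotalCoresolution.of_isShortExact {k : ℕ} {f : A →ₗ[R] N} {g : N →ₗ[R] B}
    (h : IsShortExact R f g) (hA : HasTotalCoresolution R k A) (hB : HasTotalCoresolution R k B) :
    HasTotalCoresolution R k N := by
  induction k generalizing A N B with
  | zero => trivial
  | succ k ih =>
    obtain ⟨hAL, P, A', _, _, _, _, i, p, hP, hs, hA'⟩ := hA
    obtain ⟨hBL, Q, B', _, _, _, _, j, q, hQ, hs', hB'⟩ := hB
    obtain ⟨a, ha⟩ := h.exists_extension (hBL P hP) i
    obtain ⟨C, _, _, _, u, v, hC, huv⟩ := h.exists_horseshoe hs hs' ha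
    exact ⟨fun L _ _ hL => h.extZero_middle (hAL L hL) (hBL L hL), _, C, _, _, _, _, _, _,
      inferInstance, hC, ih huv hA' hB'⟩

section CompleteResolution

variable {T : ℤ → Type u} [∀ i, AddCommGroup (T i)] [∀ i, Module R (T i)]
  {d : ∀ i, T i →ₗ[R] T (i + 1)}

theorem isShortExact_range_of_exact (hd : ∀ i, LinearMap.range (d i) = LinearMap.ker (d (i + 1)))
    (i : ℤ) : IsShortExact R (LinearMap.range (d i)).subtype (d (i + 1)).rangeRestrict :=
  ⟨Subtype.val_injective, LinearMap.surjective_rangeRestrict _, by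
    rw [Submodule.range_subtype, LinearMap.ker_rangeRestrict, hd]⟩

theorem extZero_range_of_exact (hT : ∀ i, Module.Projective R (T i))
    (hd : ∀ i, LinearMap.range (d i) = LinearMap.ker (d (i + 1)))
    (hext : ∀ (i : ℤ) (g : T (i + 1) →ₗ[R] L), g.comp (d i) = 0 →
      ∃ h : T (i + 1 + 1) →ₗ[R] L, h.comp (d (i + 1)) = g) (k : ℕ) (i : ℤ) :
    ExtZero R (LinearMap.range (d i)) L (k + 1) := by
  induction k generalizing i with
  | zero =>
    obtain ⟨j, rfl⟩ : ∃ j, i = j + 1 + 1 := ⟨i - 2, by ring⟩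
    refine (isShortExact_range_of_exact hd (j + 1)).extZero_one_of_extension fun φ => ?_
    obtain ⟨ψ, hψ⟩ := hext j (φ.comp (d (j + 1)).rangeRestrict) (by
      ext x
      have : (d (j + 1)).rangeRestrict (d j x) = 0 :=
        Subtype.ext ((hd j).le (LinearMap.mem_range_self _ x))
      simp [this])
    refine ⟨ψ, ?_⟩
    ext ⟨_, x, rfl⟩
    exact LinearMap.congr_fun hψ x
  | succ k ih =>
    obtain ⟨j, rfl⟩ : ∃ j, i = j + 1 := ⟨i - 1, by ring⟩
    exact (isShortExact_range_of_exact hd j).extZero_right (ih j) (.of_projective _)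

end CompleteResolution

theorem IsGorensteinProjective.extZero (h : IsGorensteinProjective R M)
    [Module.Projective R L] (k : ℕ) : ExtZero R M L (k + 1) := by
  obtain ⟨T, _, _, d, hT, hd, ⟨e⟩, hext⟩ := h
  exact (extZero_range_of_exact hT hd (hext L _ _ ‹_›) k 0).of_retract
    (s := e.toLinearMap) (r := e.symm.toLinearMap) (by ext; simp)

theorem IsGorensteinProjective.hasTotalCoresolution (h : IsGorensteinProjective R M) (k : ℕ) :
    HasTotalCoresolution R k M := by
  obtain ⟨T, _, _, d, hT, hd, ⟨e⟩, hext⟩ := h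
  refine HasTotalCoresolution.of_equiv ?_ e
  generalize (0 : ℤ) = i
  induction k generalizing i with
  | zero => trivial
  | succ k ih =>
    exact ⟨fun L _ _ hL => extZero_range_of_exact hT hd (hext L _ _ hL) 0 i, _, _, _, _, _, _,
      _, _, hT _, isShortExact_range_of_exact hd i, ih _⟩

theorem GProjDimLE.extZero {n : ℕ} (h : GProjDimLE R M n) [Module.Projective R L] {i : ℕ}
    (hi : n < i) : ExtZero R M L i := by
  induction n generalizing M i with
  | zero =>
    obtain ⟨G, _, _, hG, ⟨e⟩⟩ := h.exists_of_zero
    obtain ⟨i, rfl⟩ := Nat.exists_eq_add_of_lt hi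
    exact (hG.extZero (0 + i)).of_retract (s := e.toLinearMap) (r := e.symm.toLinearMap)
      (by ext; simp)
  | succ n ih =>
    obtain ⟨K, G, _, _, _, _, f, g, hK, hG, hs⟩ := h.exists_of_succ
    obtain ⟨i, rfl⟩ : ∃ j, i = j + 1 := ⟨i - 1, by omega⟩
    exact hs.extZero_right (ih hK (by omega)) (hG.extZero i)

/-- A module of Gorenstein projective dimension at most `n` embeds into a module of projective
dimension at most `n`, with a cokernel which is as close to Gorenstein projective as needed. -/
theorem GProjDimLE.exists_embedding {n : ℕ} (h : GProjDimLE R M n) (k : ℕ) :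
    ∃ (Q C : Type u) (_ : AddCommGroup Q) (_ : Module R Q) (_ : AddCommGroup C) (_ : Module R C)
      (f : M →ₗ[R] Q) (g : Q →ₗ[R] C), IsShortExact R f g ∧ HasTotalCoresolution R k C ∧
      ∀ (Y : Type u) [AddCommGroup Y] [Module R Y] (i : ℕ), n < i → ExtZero R Q Y i := by
  induction n generalizing M k with
  | zero =>
    obtain ⟨G, _, _, hG, ⟨e⟩⟩ := h.exists_of_zero
    obtain ⟨-, P, N, _, _, _, _, f, g, hP, hs, hN⟩ := (hG.hasTotalCoresolution (k + 1)).of_equiv e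
    refine ⟨P, N, _, _, _, _, f, g, hs, hN, fun Y _ _ i hi => ?_⟩
    obtain ⟨i, rfl⟩ := Nat.exists_eq_add_of_lt hi
    exact .of_projective _
  | succ n ih =>
    obtain ⟨K, G, _, _, _, _, κ, ε, hK, hG, hM⟩ := h.exists_of_succ
    obtain ⟨-, P, G', _, _, _, _, i, p, hP, hGP, hG'⟩ := hG.hasTotalCoresolution (k + 1)
    obtain ⟨Q', C', _, _, _, _, f, g, hs, ⟨hC'L, P', C'', _, _, _, _, j, q, hP', hCP, hC''⟩, hQ'⟩ :=
      ih hK (k + 1)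
    obtain ⟨A, _, _, q', s, t, hA, hMA⟩ := hM.exists_comp hGP
    obtain ⟨a, ha⟩ := hs.exists_extension (hC'L P hP) (i.comp κ)
    obtain ⟨Q, _, _, _, u, v, hQ, huv⟩ := hs.exists_horseshoe hA hCP ha
    obtain ⟨C, _, _, w, _, _, hMQ, hC⟩ := hMA.exists_comp huv
    refine ⟨Q, C, _, _, _, _, _, w, hMQ, .of_isShortExact hC hG' hC'', fun Y _ _ m hm => ?_⟩
    obtain ⟨m, rfl⟩ : ∃ j, m = j + 1 := ⟨m - 1, by omega⟩
    exact hQ.extZero_right (hQ' Y m (by omega)) (.of_projective m)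

theorem GProjDimLE.extZero_of_injective {n : ℕ} (h : GProjDimLE R M n) [Module.Injective R M]
    {i : ℕ} (hi : n < i) : ExtZero R M Y i := by
  obtain ⟨Q, C, _, _, _, _, f, g, hs, -, hQ⟩ := h.exists_embedding 0
  obtain ⟨r, hr⟩ := Module.Injective.out f hs.1 LinearMap.id
  exact (hQ Y i hi).of_retract (LinearMap.ext hr)

variable (R) in
/-- Every module is an extension of itself by itself with middle term of projective dimension at
most one. -/
def HasProjectiveSelfExtensions : Prop :=
  ∀ (M : Type u) (_ : AddCommGroup M) (_ : Module R M),
    ∃ (Q : Type u) (_ : AddCommGroup Q) (_ : Module R Q)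
      (ι : M →ₗ[R] Q) (π : Q →ₗ[R] M), IsShortExact R ι π ∧ ProjDimLE R Q 1

variable (R) in
/-- Every module is an extension of itself by itself with middle term of injective dimension at
most one. -/
def HasInjectiveSelfExtensions : Prop :=
  ∀ (M : Type u) (_ : AddCommGroup M) (_ : Module R M),
    ∃ (E : Type u) (_ : AddCommGroup E) (_ : Module R E)
      (ι : M →ₗ[R] E) (π : E →ₗ[R] M), IsShortExact R ι π ∧ InjDimLE R E 1

theorem isShortExact_of_equiv_range {f : P →ₗ[R] P} (hf : LinearMap.range f = LinearMap.ker f)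
    (e : N ≃ₗ[R] LinearMap.range f) :
    IsShortExact R ((LinearMap.range f).subtype.comp e.toLinearMap)
      (e.symm.toLinearMap.comp f.rangeRestrict) :=
  ⟨Subtype.val_injective.comp e.injective, e.symm.surjective.comp f.surjective_rangeRestrict, by
    rw [LinearEquiv.range_comp, Submodule.range_subtype, LinearEquiv.ker_comp,
      LinearMap.ker_rangeRestrict, hf]⟩

theorem IsSGHereditaryRing.hasProjectiveSelfExtensions (h : IsSGHereditaryRing R) :
    HasProjectiveSelfExtensions R := by
  intro M _ _
  have hs := IsShortExact.subtype_ker (Finsupp.linearCombination_surjective R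
    (v := (id : M → M)) Function.surjective_id)
  obtain ⟨P, _, _, f, hP, hf, ⟨e⟩, hext⟩ := h _ _ _ inferInstance
    (LinearMap.ker (Finsupp.linearCombination R (id : M → M)))
  have hN := isShortExact_of_equiv_range
    (N := LinearMap.ker (Finsupp.linearCombination R (id : M → M))) hf e
  obtain ⟨a, ha⟩ := hext _ _ _ inferInstance
    ((Submodule.subtype _).comp (e.symm.toLinearMap.comp f.rangeRestrict)) (by
      ext1 x
      have : f.rangeRestrict (f x) = 0 := Subtype.ext (hf.le (LinearMap.mem_range_self f x))
      simp [this])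
  obtain ⟨Q, _, _, q, u, v, hQ, huv⟩ := hN.exists_horseshoe hs hs (a := a) (by
    ext1 x
    obtain ⟨y, hy⟩ := (e x).2
    have hy' : f.rangeRestrict y = e x := Subtype.ext hy
    have := LinearMap.congr_fun ha y
    simp only [LinearMap.comp_apply, hy', LinearEquiv.coe_coe, e.symm_apply_apply] at this
    simp only [LinearMap.comp_apply, LinearEquiv.coe_coe, Submodule.subtype_apply, ← hy]
    exact this)
  exact ⟨Q, _, _, u, v, huv, projDimLE_one_iff.2 ⟨_, _, _, _, _, _, _, _, hP, inferInstance, hQ⟩⟩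

/-- If extension groups vanish in some degree above `2`, and every shift by one degree can be
undone, then they vanish in degree `2`. -/
theorem forall_of_shift {p : ℕ → Prop} {n : ℕ} (hn : p (n + 2))
    (hp : ∀ i, p (i + 3) → p (i + 2)) : p 2 := by
  induction n with
  | zero => exact hn
  | succ n ih => exact ih (hp n hn)

theorem HasProjectiveSelfExtensions.extZero_two (h : HasProjectiveSelfExtensions R) {n : ℕ}
    (hfin : ∀ (M : Type u) (_ : AddCommGroup M) (_ : Module R M), GProjDimLE R M n)
    [Module.Projective R L] : ExtZero R M L 2 := by
  obtain ⟨Q, _, _, ι, π, hs, hQ⟩ := h M _ _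
  refine forall_of_shift (p := ExtZero R M L) ((hfin M _ _).extZero (by omega : n < n + 2)) ?_
  exact fun i hi => hs.extZero_left (hQ.extZero i) hi

theorem HasProjectiveSelfExtensions.isSGHereditaryRing (h : HasProjectiveSelfExtensions R) {n : ℕ}
    (hfin : ∀ (M : Type u) (_ : AddCommGroup M) (_ : Module R M), GProjDimLE R M n) :
    IsSGHereditaryRing R := by
  intro P _ _ hP N
  obtain ⟨Q, _, _, ι, π, hs, hQ⟩ := h (P ⧸ N) _ _
  have hN : IsShortExact R N.subtype N.mkQ :=
    ⟨Subtype.val_injective, N.mkQ_surjective, by rw [Submodule.range_subtype, Submodule.ker_mkQ]⟩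
  obtain ⟨K, _, _, k, q, α, β, hK, hαβ⟩ := hs.exists_projective_horseshoe hN
  refine ⟨K, _, _, α.comp β, ?_, ?_, ?_, ?_⟩
  · exact projective_of_extZero fun Y => hK.extZero_left (.of_projective 0) (hQ.extZero 0)
  · rw [LinearMap.range_comp_of_range_eq_top _ (LinearMap.range_eq_top.2 hαβ.2.1), hαβ.2.2,
      LinearMap.ker_comp_of_ker_eq_bot _ (LinearMap.ker_eq_bot.2 hαβ.1)]
  · rw [LinearMap.range_comp_of_range_eq_top _ (LinearMap.range_eq_top.2 hαβ.2.1)]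
    exact ⟨.ofInjective α hαβ.1⟩
  · intro L _ _ hL g hg
    obtain ⟨φ, rfl⟩ := hαβ.exists_factor g (by
      ext x
      obtain ⟨y, rfl⟩ := hαβ.2.1 x
      exact LinearMap.congr_fun hg y)
    obtain ⟨ψ, rfl⟩ := hαβ.exists_extension
      (hN.extZero_left (.of_projective 0) (h.extZero_two hfin)) φ
    exact ⟨ψ, rfl⟩

theorem HasProjectiveSelfExtensions.hasInjectiveSelfExtensions
    (h : HasProjectiveSelfExtensions R) {n : ℕ}
    (hfin : ∀ (M : Type u) (_ : AddCommGroup M) (_ : Module R M), GProjDimLE R M n) :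
    HasInjectiveSelfExtensions R := by
  intro M _ _
  obtain ⟨Q, _, _, ι, π, hs, hQ⟩ := h M _ _
  refine ⟨Q, _, _, ι, π, hs, injDimLE_one_of_extZero fun X _ _ => ?_⟩
  obtain ⟨P₁, P₀, _, _, _, _, f, g, _, _, hP⟩ := projDimLE_one_iff.1 hQ
  have hs₁ := IsShortExact.subtype_ker (Finsupp.linearCombination_surjective R
    (v := (id : X → X)) Function.surjective_id)
  exact hP.extZero_of_right (h.extZero_two hfin)
    (hs₁.extZero_right (h.extZero_two hfin) (.of_projective 2))

theorem HasInjectiveSelfExtensions.extZero_two (h : HasInjectiveSelfExtensions R) {n : ℕ}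
    (hfin : ∀ (M : Type u) (_ : AddCommGroup M) (_ : Module R M), GProjDimLE R M n)
    [Module.Injective R M] : ExtZero R M Y 2 := by
  obtain ⟨E, _, _, ι, π, hs, hE⟩ := h Y _ _
  refine forall_of_shift (p := ExtZero R M Y)
    ((hfin M _ _).extZero_of_injective (by omega : n < n + 2)) ?_
  exact fun i hi => hs.extZero_of_right (hE.extZero i) hi

theorem HasInjectiveSelfExtensions.hasProjectiveSelfExtensions
    (h : HasInjectiveSelfExtensions R) {n : ℕ}
    (hfin : ∀ (M : Type u) (_ : AddCommGroup M) (_ : Module R M), GProjDimLE R M n) :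
    HasProjectiveSelfExtensions R := by
  intro M _ _
  obtain ⟨E, _, _, ι, π, hs, hE⟩ := h M _ _
  refine ⟨E, _, _, ι, π, hs, projDimLE_one_of_extZero fun Y _ _ => ?_⟩
  obtain ⟨I₀, I₁, _, _, _, _, f, g, _, _, hI⟩ := injDimLE_one_iff.1 hE
  obtain ⟨E', _, _, ι', π', hs', hE'⟩ := h Y _ _
  have hI₁ : ExtZero R I₁ Y 3 := hs'.extZero_of_left (h.extZero_two hfin) (hE'.extZero 1)
  exact hI.extZero_left (h.extZero_two hfin) hI₁

end HomologicalLemmas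

/-- Corollary 2.5: characterization of strongly Gorenstein hereditary rings among rings of
finite Gorenstein global dimension. -/
theorem statement_3 (R : Type u) [CommRing R]
    (hfin : ∃ n : ℕ, ∀ (M : Type u) (_ : AddCommGroup M) (_ : Module R M), GProjDimLE R M n) :
    List.TFAE
      [ IsSGHereditaryRing R,
        ∀ (M : Type u) (_ : AddCommGroup M) (_ : Module R M),
          ∃ (Q : Type u) (_ : AddCommGroup Q) (_ : Module R Q)
            (ι : M →ₗ[R] Q) (π : Q →ₗ[R] M), IsShortExact R ι π ∧ ProjDimLE R Q 1,
        ∀ (M : Type u) (_ : AddCommGroup M) (_ : Module R M),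
          ∃ (E : Type u) (_ : AddCommGroup E) (_ : Module R E)
            (ι : M →ₗ[R] E) (π : E →ₗ[R] M), IsShortExact R ι π ∧ InjDimLE R E 1 ] := by
  obtain ⟨n, hfin⟩ := hfin
  tfae_have 1 → 2 := IsSGHereditaryRing.hasProjectiveSelfExtensions
  tfae_have 2 → 1 := fun h => HasProjectiveSelfExtensions.isSGHereditaryRing h hfin
  tfae_have 2 → 3 := fun h => HasProjectiveSelfExtensions.hasInjectiveSelfExtensions h hfin
  tfae_have 3 → 2 := fun h => HasInjectiveSelfExtensions.hasProjectiveSelfExtensions h hfin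
  tfae_finish
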